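/- arXiv:math/0406368 — 3 statements merged into one kernel-verified Lean document; each statement's English description precedes it below -/
import Mathlib

section
/- For every z in the open unit disk D, ∫₀¹ (1−r)^{−2}·χ_{𝔻(r,1−r)}(z) dr = (1−|z|²)/|1−z|², where χ_{𝔻(r,1−r)} is the characteristic function of the open disk with center r and radius 1−r. -/
open Complex MeasureTheory Metric Set ComplexConjugate
noncomputable section

/-- The disk of center `r` and radius `1 - r` contains `z` exactly when `r` lies below an
explicit threshold. -/
theorem mem_ball_ofReal_one_sub_iff {z : ℂ} (hz : z.re < 1) {r : ℝ} (hr : r ≤ 1) :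
    z ∈ ball (r : ℂ) (1 - r) ↔ r < (1 - normSq z) / (2 * (1 - z.re)) := by
  rw [mem_ball, Complex.dist_eq, ← sq_lt_sq₀ (norm_nonneg _) (by linarith),
    ← Complex.normSq_eq_norm_sq, lt_div_iff₀ (by linarith)]
  simp only [normSq_apply, sub_re, sub_im, ofReal_re, ofReal_im]
  constructor <;> intro h <;> linarith

theorem integral_inv_one_sub_sq {c : ℝ} (hc₀ : 0 ≤ c) (hc : c < 1) :
    ∫ r in (0 : ℝ)..c, ((1 - r) ^ 2)⁻¹ = c / (1 - c) := by
  have hne : ∀ r ∈ uIcc 0 c, 1 - r ≠ 0 := fun r hr ↦ by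
    rw [uIcc_of_le hc₀] at hr
    exact (sub_pos.2 (hr.2.trans_lt hc)).ne'
  rw [intervalIntegral.integral_eq_sub_of_hasDerivAt (f := fun r ↦ (1 - r)⁻¹)]
  · have : 1 - c ≠ 0 := by linarith
    field_simp
    ring
  · intro r hr
    have h := ((hasDerivAt_id' r).const_sub 1).fun_inv (hne r hr)
    rwa [neg_neg, one_div] at h
  · refine ContinuousOn.intervalIntegrable (ContinuousOn.inv₀ (by fun_prop) fun r hr ↦ ?_)
    exact pow_ne_zero 2 (hne r hr)

/-- For every `z` in the open unit disk,
`∫₀¹ (1-r)⁻² χ_{𝔻(r,1-r)}(z) dr = (1-|z|²)/|1-z|²`. -/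
theorem statement15 :
    ∀ z ∈ ball (0:ℂ) 1,
      (∫ r in (0:ℝ)..1,
          ((1 - r) ^ 2)⁻¹ * Set.indicator (ball ((r : ℂ)) (1 - r)) (fun _ => (1:ℝ)) z)
        = (1 - normSq z) / normSq (1 - z) := by
  intro z hz
  rw [mem_ball_zero_iff] at hz
  have hre : z.re < 1 := (re_le_norm z).trans_lt hz
  have hsq : normSq z < 1 := by
    rw [Complex.normSq_eq_norm_sq]
    exact pow_lt_one₀ (norm_nonneg z) hz two_ne_zero
  have hN : normSq (1 - z) = 2 * (1 - z.re) - (1 - normSq z) := by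
    simp only [normSq_apply, sub_re, sub_im, one_re, one_im]
    ring
  have hNpos : 0 < normSq (1 - z) := normSq_pos.2 fun h ↦ by
    rw [← sub_eq_zero.1 h] at hre
    simp at hre
  set c := (1 - normSq z) / (2 * (1 - z.re)) with hc
  have hc₀ : 0 ≤ c := div_nonneg (by linarith) (by linarith)
  have hc₁ : c < 1 := by
    rw [hc, div_lt_one (by linarith)]
    linarith
  have hcongr : EqOn
      (fun r : ℝ ↦ ((1 - r) ^ 2)⁻¹ * Set.indicator (ball (r : ℂ) (1 - r)) (fun _ ↦ (1 : ℝ)) z)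
      ((Iio c).indicator fun r ↦ ((1 - r) ^ 2)⁻¹) (Ioc 0 1) := fun r hr ↦ by
    have hiff : z ∈ ball (r : ℂ) (1 - r) ↔ r ∈ Iio c := mem_ball_ofReal_one_sub_iff hre hr.2
    by_cases h : r ∈ Iio c
    · simp only [indicator_of_mem h, indicator_of_mem (hiff.2 h), mul_one]
    · simp only [indicator_of_notMem h, indicator_of_notMem (mt hiff.1 h), mul_zero]
  have hinter : Ioc 0 1 ∩ Iio c = Ioo 0 c := by
    ext r
    simp only [mem_inter_iff, mem_Ioc, mem_Iio, mem_Ioo]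
    exact ⟨fun h ↦ ⟨h.1.1, h.2⟩, fun h ↦ ⟨⟨h.1, (h.2.trans hc₁).le⟩, h.2⟩⟩
  rw [intervalIntegral.integral_of_le zero_le_one, setIntegral_congr_fun measurableSet_Ioc hcongr,
    setIntegral_indicator measurableSet_Iio, hinter, ← integral_Ioc_eq_integral_Ioo,
    ← intervalIntegral.integral_of_le hc₀, integral_inv_one_sub_sq hc₀ hc₁]
  have h₁ : 1 - c ≠ 0 := by linarith
  have h₂ : c * (2 * (1 - z.re)) = 1 - normSq z := div_mul_cancel₀ _ (by linarith)
  rw [div_eq_div_iff h₁ hNpos.ne', hN, ← h₂]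
  ring
end
end

section
/- Let ω be a nonnegative measurable function on the open unit disk D, integrable with respect to dΣ, which is reproducing at the origin in the sense that h(0) = ∫_D h(z)ω(z) dΣ(z) for all harmonic polynomials h. Then ∫_D ((1−|z|²)/|1−z|²)·ω(z) dΣ(z) ≤ 1. -/
open Complex MeasureTheory Metric Set ComplexConjugate
noncomputable section

/-- The normalized area measure `dΣ = dx dy / π` on `ℂ`. -/
def areaM : Measure ℂ := (ENNReal.ofReal Real.pi)⁻¹ • (volume : Measure ℂ)

/-- A harmonic polynomial: of the form `p(z) + conj (q(z))` for complex polynomials `p, q`. -/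
def IsHarmonicPolynomial (h : ℂ → ℝ) : Prop :=
  ∃ p q : Polynomial ℂ, ∀ z : ℂ, (h z : ℂ) = p.eval z + conj (q.eval z)

open Filter Topology

/-- The Poisson kernel on the disk is the real part of the Cayley transform. -/
lemma re_cayley {w : ℂ} (h : w ≠ 1) :
    (-1 + 2 * (1 - w)⁻¹).re = (1 - normSq w) / normSq (1 - w) := by
  have h0 : normSq (1 - w) ≠ 0 := by
    rw [Ne, normSq_eq_zero, sub_eq_zero]
    exact fun e => h e.symm
  have h1 : (-1 + 2 * (1 - w)⁻¹).re = -1 + 2 * ((1 - w.re) / normSq (1 - w)) := by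
    simp [Complex.mul_re, Complex.inv_re]
  rw [h1, eq_div_iff h0]
  field_simp
  simp only [normSq_apply, sub_re, sub_im, one_re, one_im]
  ring

/-- The real part of a complex polynomial is a harmonic polynomial. -/
lemma IsHarmonicPolynomial.re_eval (p : Polynomial ℂ) :
    IsHarmonicPolynomial fun z => (p.eval z).re := by
  refine ⟨Polynomial.C (1 / 2) * p, Polynomial.C (1 / 2) * p, fun z => ?_⟩
  rw [Complex.re_eq_add_conj]
  have h2 : conj (2 : ℂ) = 2 := Complex.conj_ofNat 2
  simp [h2]
  ring

/-- Partial sums of the power series of the Cayley transform `(1 + r z) / (1 - r z)`. -/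
def cayleyPartialSum (r : ℝ) (N : ℕ) : Polynomial ℂ :=
  -1 + 2 * ∑ n ∈ Finset.range N, (Polynomial.C (r : ℂ) * Polynomial.X) ^ n

lemma eval_cayleyPartialSum (r : ℝ) (N : ℕ) (z : ℂ) :
    (cayleyPartialSum r N).eval z = -1 + 2 * ∑ n ∈ Finset.range N, (r * z) ^ n := by
  simp [cayleyPartialSum, Polynomial.eval_finsetSum]

lemma norm_ofReal_mul_le {r : ℝ} (hr : 0 ≤ r) {z : ℂ} (hz : z ∈ ball (0 : ℂ) 1) :
    ‖(r : ℂ) * z‖ ≤ r := by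
  rw [mem_ball_zero_iff] at hz
  rw [norm_mul, Complex.norm_real, Real.norm_of_nonneg hr]
  nlinarith

lemma norm_eval_cayleyPartialSum_le {r : ℝ} (hr : 0 ≤ r) (hr1 : r < 1) (N : ℕ) {z : ℂ}
    (hz : z ∈ ball (0 : ℂ) 1) :
    ‖(cayleyPartialSum r N).eval z‖ ≤ 1 + 2 * (1 - r)⁻¹ := by
  have h : ‖∑ n ∈ Finset.range N, ((r : ℂ) * z) ^ n‖ ≤ (1 - r)⁻¹ := by
    calc _ ≤ ∑ n ∈ Finset.range N, r ^ n := by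
          refine norm_sum_le_of_le _ fun n _ => ?_
          rw [norm_pow]
          exact pow_le_pow_left₀ (norm_nonneg _) (norm_ofReal_mul_le hr hz) n
      _ ≤ ∑' n, r ^ n :=
          (summable_geometric_of_lt_one hr hr1).sum_le_tsum _ fun n _ => pow_nonneg hr n
      _ = _ := tsum_geometric_of_lt_one hr hr1
  rw [eval_cayleyPartialSum]
  refine (norm_add_le _ _).trans ?_
  rw [norm_mul, norm_neg, norm_one, Complex.norm_ofNat]
  linarith

lemma tendsto_re_eval_cayleyPartialSum {r : ℝ} (hr : 0 ≤ r) (hr1 : r < 1) {z : ℂ}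
    (hz : z ∈ ball (0 : ℂ) 1) :
    Tendsto (fun N => ((cayleyPartialSum r N).eval z).re) atTop
      (𝓝 ((1 - normSq (r * z)) / normSq (1 - r * z))) := by
  have hlt : ‖(r : ℂ) * z‖ < 1 := (norm_ofReal_mul_le hr hz).trans_lt hr1
  have hne : (r : ℂ) * z ≠ 1 := by
    intro h
    simp [h] at hlt
  rw [← re_cayley hne]
  simp only [eval_cayleyPartialSum]
  exact (Complex.continuous_re.tendsto _).comp
    (((hasSum_geometric_of_norm_lt_one hlt).tendsto_sum_nat.const_mul 2).const_add (-1))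

lemma lintegral_poisson_dilate_eq_one (ω : ℂ → ℝ)
    (hnn : ∀ z ∈ ball (0 : ℂ) 1, 0 ≤ ω z)
    (hint : IntegrableOn ω (ball (0 : ℂ) 1) areaM)
    (hrep : ∀ h : ℂ → ℝ, IsHarmonicPolynomial h →
      h 0 = ∫ z in ball (0 : ℂ) 1, h z * ω z ∂areaM)
    {r : ℝ} (hr : 0 ≤ r) (hr1 : r < 1) :
    AEMeasurable (fun z => ENNReal.ofReal
        ((1 - normSq (r * z)) / normSq (1 - r * z) * ω z)) (areaM.restrict (ball 0 1)) ∧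
    ∫⁻ z in ball (0 : ℂ) 1,
      ENNReal.ofReal ((1 - normSq (r * z)) / normSq (1 - r * z) * ω z) ∂areaM = 1 := by
  have hmem : ∀ᵐ z ∂areaM.restrict (ball (0 : ℂ) 1), z ∈ ball (0 : ℂ) 1 :=
    ae_restrict_mem measurableSet_ball
  have hmeas : ∀ N, AEStronglyMeasurable
      (fun z => ((cayleyPartialSum r N).eval z).re * ω z) (areaM.restrict (ball 0 1)) :=
    fun N => (Complex.continuous_re.comp
      (cayleyPartialSum r N).continuous).aestronglyMeasurable.mul hint.aestronglyMeasurable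
  have hbound : ∀ N, ∀ᵐ z ∂areaM.restrict (ball (0 : ℂ) 1),
      ‖((cayleyPartialSum r N).eval z).re * ω z‖ ≤ (1 + 2 * (1 - r)⁻¹) * ‖ω z‖ := by
    intro N
    filter_upwards [hmem] with z hz
    rw [norm_mul]
    gcongr
    exact (Complex.abs_re_le_norm _).trans (norm_eval_cayleyPartialSum_le hr hr1 N hz)
  have hlim : ∀ᵐ z ∂areaM.restrict (ball (0 : ℂ) 1),
      Tendsto (fun N => ((cayleyPartialSum r N).eval z).re * ω z) atTop
        (𝓝 ((1 - normSq (r * z)) / normSq (1 - r * z) * ω z)) := by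
    filter_upwards [hmem] with z hz
    exact (tendsto_re_eval_cayleyPartialSum hr hr1 hz).mul_const _
  have hdom : Integrable (fun z => (1 + 2 * (1 - r)⁻¹) * ‖ω z‖)
      (areaM.restrict (ball 0 1)) := hint.norm.const_mul _
  have hK : Integrable (fun z : ℂ => (1 - normSq (r * z)) / normSq (1 - r * z) * ω z)
      (areaM.restrict (ball 0 1)) :=
    ⟨aestronglyMeasurable_of_tendsto_ae _ hmeas hlim,
      hasFiniteIntegral_of_dominated_convergence hdom.hasFiniteIntegral hbound hlim⟩
  have hone : ∀ N, ∫ z in ball (0 : ℂ) 1,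
      ((cayleyPartialSum r (N + 1)).eval z).re * ω z ∂areaM = 1 := by
    intro N
    rw [← hrep _ (IsHarmonicPolynomial.re_eval _), eval_cayleyPartialSum]
    simp [Finset.sum_range_succ']
    norm_num
  have hKone : ∫ z in ball (0 : ℂ) 1,
      (1 - normSq (r * z)) / normSq (1 - r * z) * ω z ∂areaM = 1 := by
    refine tendsto_nhds_unique ((tendsto_add_atTop_iff_nat 1).2
      (tendsto_integral_of_dominated_convergence _ hmeas hdom hbound hlim)) ?_
    simp only [hone]
    exact tendsto_const_nhds
  refine ⟨hK.aestronglyMeasurable.aemeasurable.ennreal_ofReal, ?_⟩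
  rw [← ofReal_integral_eq_lintegral_ofReal hK, hKone, ENNReal.ofReal_one]
  filter_upwards [hmem] with z hz
  refine mul_nonneg (div_nonneg ?_ (normSq_nonneg _)) (hnn z hz)
  have := norm_ofReal_mul_le hr hz
  rw [normSq_eq_norm_sq]
  nlinarith [norm_nonneg ((r : ℂ) * z)]

/-- If `ω ≥ 0` is integrable on the unit disk and reproducing at the origin for harmonic
polynomials, then `∫_D (1-|z|²)/|1-z|² ω(z) dΣ(z) ≤ 1`. -/
theorem statement16 (ω : ℂ → ℝ)
    (hnn : ∀ z ∈ ball (0:ℂ) 1, 0 ≤ ω z)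
    (hint : IntegrableOn ω (ball (0:ℂ) 1) areaM)
    (hrep : ∀ h : ℂ → ℝ, IsHarmonicPolynomial h →
      h 0 = ∫ z in ball (0:ℂ) 1, h z * ω z ∂areaM) :
    (∫⁻ z in ball (0:ℂ) 1,
        ENNReal.ofReal ((1 - normSq z) / normSq (1 - z) * ω z) ∂areaM) ≤ 1 := by
  obtain ⟨r, -, hr, hr_lim⟩ := exists_seq_strictMono_tendsto' (zero_lt_one' ℝ)
  have key := fun n =>
    lintegral_poisson_dilate_eq_one ω hnn hint hrep (hr n).1.le (hr n).2
  calc _ = ∫⁻ z in ball (0 : ℂ) 1, liminf (fun n => ENNReal.ofReal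
          ((1 - normSq (r n * z)) / normSq (1 - r n * z) * ω z)) atTop ∂areaM := by
        refine setLIntegral_congr_fun measurableSet_ball fun z hz => ?_
        have hne : normSq (1 - z) ≠ 0 := by
          rw [Ne, normSq_eq_zero, sub_eq_zero]
          rintro rfl
          simp at hz
        have hw : Tendsto (fun n => (r n : ℂ) * z) atTop (𝓝 z) := by
          simpa using ((Complex.continuous_ofReal.tendsto 1).comp hr_lim).mul_const z
        have hnum := ((continuous_normSq.tendsto z).comp hw).const_sub 1
        have hden := (continuous_normSq.tendsto (1 - z)).comp (hw.const_sub 1)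
        exact (ENNReal.tendsto_ofReal
          ((hnum.div hden hne).mul_const (ω z))).liminf_eq.symm
    _ ≤ liminf (fun n => ∫⁻ z in ball (0 : ℂ) 1, ENNReal.ofReal
          ((1 - normSq (r n * z)) / normSq (1 - r n * z) * ω z) ∂areaM) atTop :=
        lintegral_liminf_le' fun n => (key n).1
    _ = 1 := by simp only [fun n => (key n).2, liminf_const]
end
end

section
/- For every ε > 0 there exists r_ε with 0 < r_ε < 1 such that for all r with r_ε < r < 1, (1/(1−r)²) ∫_{𝔻(r,1−r)} log(1/(1−|z|²)) dΣ(z) ≤ (4/π + ε)·log(1/(1−r)). Equivalently, the function F(r) = exp{(1−r)^{−2} ∫_{𝔻(r,1−r)} log(1/(1−|z|²)) dΣ(z)} satisfies F(r) ≤ (1−r)^{−4/π−ε} for r_ε < r < 1. -/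
open Complex MeasureTheory Metric Set ComplexConjugate
noncomputable section

/-- `F(r) = exp{(1-r)⁻² ∫_{𝔻(r,1-r)} log(1/(1-|z|²)) dΣ(z)}`. -/
def Fkor (r : ℝ) : ℝ :=
  Real.exp (((1 - r) ^ 2)⁻¹ *
    ∫ z in ball ((r : ℂ)) (1 - r), Real.log (1 / (1 - normSq z)) ∂areaM)

lemma normSq_lt_of_mem_ball {r : ℝ} {z : ℂ} (hz : z ∈ ball (r : ℂ) (1 - r)) :
    normSq z < 1 - 2 * r * (1 - z.re) := by
  rw [mem_ball, dist_eq_norm] at hz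
  have h : normSq (z - r) < (1 - r) ^ 2 := by
    rw [normSq_eq_norm_sq]
    gcongr
  simp only [normSq_apply, sub_re, sub_im, ofReal_re, ofReal_im] at h ⊢
  nlinarith

lemma re_mem_of_mem_ball {r : ℝ} {z : ℂ} (hz : z ∈ ball (r : ℂ) (1 - r)) :
    z.re ∈ Ioo (2 * r - 1) 1 := by
  rw [mem_ball, dist_eq_norm] at hz
  have h := abs_lt.1 ((abs_re_le_norm (z - r)).trans_lt hz)
  simp only [sub_re, ofReal_re] at h
  constructor <;> linarith

lemma im_mem_of_mem_ball {r : ℝ} {z : ℂ} (hz : z ∈ ball (r : ℂ) (1 - r)) :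
    z.im ∈ Ioo (-(1 - r)) (1 - r) := by
  rw [mem_ball, dist_eq_norm] at hz
  have h := abs_lt.1 ((abs_im_le_norm (z - r)).trans_lt hz)
  simpa using h

lemma log_one_div_one_sub_normSq_le {r : ℝ} (hr : 1 / 2 ≤ r) (hr1 : r < 1) {z : ℂ}
    (hz : z ∈ ball (r : ℂ) (1 - r)) :
    Real.log (1 / (1 - normSq z)) ≤
      Real.log (1 / (1 - r)) + 2 * √(1 - r) * (1 - z.re) ^ (-(1 / 2) : ℝ) := by
  have h1 := normSq_lt_of_mem_ball hz
  have hx : 0 < 1 - z.re := by linarith [(re_mem_of_mem_ball hz).2]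
  have hd : 0 < 1 - r := by linarith
  have h2 : 1 - z.re ≤ 1 - normSq z := by nlinarith
  have h3 : Real.log (1 / (1 - normSq z)) ≤ Real.log (1 / (1 - z.re)) := by
    gcongr
    exact div_pos one_pos (by linarith)
  have h4 : Real.log (1 / (1 - z.re)) =
      Real.log (1 / (1 - r)) + 2 * Real.log (√(1 - r) * (1 - z.re) ^ (-(1 / 2) : ℝ)) := by
    rw [Real.log_mul (by positivity) (by positivity), Real.log_rpow hx, Real.log_sqrt hd.le]
    simp only [one_div, Real.log_inv]
    ring
  have h5 := Real.log_le_self (x := √(1 - r) * (1 - z.re) ^ (-(1 / 2) : ℝ)) (by positivity)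
  linarith

lemma intervalIntegrable_one_sub_rpow (r : ℝ) :
    IntervalIntegrable (fun x : ℝ => (1 - x) ^ (-(1 / 2) : ℝ)) volume (2 * r - 1) 1 := by
  have h := (intervalIntegral.intervalIntegrable_rpow' (a := 2 * (1 - r)) (b := 0)
    (r := -(1 / 2)) (by norm_num)).comp_sub_left 1
  convert h using 1 <;> ring

lemma integral_one_sub_rpow {r : ℝ} (hr1 : r < 1) :
    ∫ x in Ioo (2 * r - 1) 1, (1 - x) ^ (-(1 / 2) : ℝ) = 2 * √(2 * (1 - r)) := by
  rw [← integral_Ioc_eq_integral_Ioo, ← intervalIntegral.integral_of_le (by linarith),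
    intervalIntegral.integral_comp_sub_left (fun x : ℝ => x ^ (-(1 / 2) : ℝ)) 1,
    integral_rpow (Or.inl (by norm_num))]
  rw [Real.sqrt_eq_rpow]
  norm_num
  ring_nf

lemma integrableOn_one_sub_re_rpow {r : ℝ} (hr1 : r < 1) :
    IntegrableOn (fun z : ℂ => (1 - z.re) ^ (-(1 / 2) : ℝ))
      (Ioo (2 * r - 1) 1 ×ℂ Ioo (-(1 - r)) (1 - r)) := by
  have h1 : IntegrableOn (fun x : ℝ => (1 - x) ^ (-(1 / 2) : ℝ)) (Ioo (2 * r - 1) 1) :=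
    ((intervalIntegrable_iff_integrableOn_Ioc_of_le (by linarith)).1
      (intervalIntegrable_one_sub_rpow r)).mono_set Ioo_subset_Ioc_self
  have h2 : IntegrableOn (fun _ : ℝ => (1 : ℝ)) (Ioo (-(1 - r)) (1 - r)) :=
    integrableOn_const (by simp)
  have h := Integrable.mul_prod h1 h2
  rw [Measure.prod_restrict] at h
  have h' := (volume_preserving_equiv_real_prod.integrableOn_comp_preimage
    measurableEquivRealProd.measurableEmbedding).2 h
  simp only [Function.comp_def, mul_one] at h'
  exact h'

lemma setIntegral_one_sub_re_rpow {r : ℝ} (hr1 : r < 1) :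
    ∫ z in Ioo (2 * r - 1) 1 ×ℂ Ioo (-(1 - r)) (1 - r), (1 - z.re) ^ (-(1 / 2) : ℝ) =
      2 * √(2 * (1 - r)) * (2 * (1 - r)) := by
  have h := volume_preserving_equiv_real_prod.setIntegral_preimage_emb
    measurableEquivRealProd.measurableEmbedding
    (fun p : ℝ × ℝ => (1 - p.1) ^ (-(1 / 2) : ℝ) * 1)
    (Ioo (2 * r - 1) 1 ×ˢ Ioo (-(1 - r)) (1 - r))
  rw [Measure.volume_eq_prod, setIntegral_prod_mul (fun x : ℝ => (1 - x) ^ (-(1 / 2) : ℝ))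
    (fun _ => (1 : ℝ)), integral_one_sub_rpow hr1] at h
  have h3 : ∫ _ in Ioo (-(1 - r)) (1 - r), (1 : ℝ) = 2 * (1 - r) := by
    simp [Measure.real, Real.volume_Ioo]
    rw [ENNReal.toReal_ofReal] <;> linarith
  rw [h3] at h
  rw [← h]
  simp only [mul_one]
  rfl

lemma setIntegral_log_one_div_one_sub_normSq_le {r : ℝ} (hr : 1 / 2 ≤ r) (hr1 : r < 1) :
    ∫ z in ball (r : ℂ) (1 - r), Real.log (1 / (1 - normSq z)) ≤
      Real.pi * (1 - r) ^ 2 * (Real.log (1 / (1 - r)) + 4) := by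
  have hd : 0 < 1 - r := by linarith
  set R := Ioo (2 * r - 1) 1 ×ℂ Ioo (-(1 - r)) (1 - r)
  have hsub : ball (r : ℂ) (1 - r) ⊆ R := fun z hz =>
    ⟨re_mem_of_mem_ball hz, im_mem_of_mem_ball hz⟩
  have hRm : MeasurableSet R :=
    (measurable_re measurableSet_Ioo).inter (measurable_im measurableSet_Ioo)
  have hintR := integrableOn_one_sub_re_rpow hr1
  have hint := (hintR.mono_set hsub).const_mul (2 * √(1 - r))
  have hconst : IntegrableOn (fun _ : ℂ => Real.log (1 / (1 - r))) (ball (r : ℂ) (1 - r)) :=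
    integrableOn_const measure_ball_lt_top.ne
  have hvol : volume.real (ball (r : ℂ) (1 - r)) = Real.pi * (1 - r) ^ 2 := by
    simp [Measure.real, Complex.volume_ball, hd.le, mul_comm]
  have hmono : ∫ z in ball (r : ℂ) (1 - r), (1 - z.re) ^ (-(1 / 2) : ℝ) ≤
      ∫ z in R, (1 - z.re) ^ (-(1 / 2) : ℝ) := by
    refine setIntegral_mono_set hintR ?_ hsub.eventuallyLE
    filter_upwards [ae_restrict_mem hRm] with z hz
    have : z.re < 1 := hz.1.2
    exact Real.rpow_nonneg (by linarith) _
  rw [setIntegral_one_sub_re_rpow hr1] at hmono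
  have hle : ∫ z in ball (r : ℂ) (1 - r), Real.log (1 / (1 - normSq z)) ≤
      ∫ z in ball (r : ℂ) (1 - r),
        (Real.log (1 / (1 - r)) + 2 * √(1 - r) * (1 - z.re) ^ (-(1 / 2) : ℝ)) := by
    refine integral_mono_of_nonneg ?_ (hconst.add hint) ?_
    · filter_upwards [ae_restrict_mem measurableSet_ball] with z hz
      have h1 := normSq_lt_of_mem_ball hz
      have h2 := (re_mem_of_mem_ball hz).2
      have h3 : 0 < 1 - normSq z := by nlinarith
      exact Real.log_nonneg ((one_le_div h3).2 (by linarith [normSq_nonneg z]))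
    · filter_upwards [ae_restrict_mem measurableSet_ball] with z hz
      exact log_one_div_one_sub_normSq_le hr hr1 hz
  rw [integral_add hconst hint, integral_const_mul, setIntegral_const, hvol, smul_eq_mul] at hle
  have hsqrt : √(1 - r) * √(2 * (1 - r)) ≤ 3 / 2 * (1 - r) := by
    rw [← Real.sqrt_mul hd.le]
    exact Real.sqrt_le_iff.2 ⟨by positivity, by nlinarith⟩
  calc _ ≤ _ := hle
    _ ≤ Real.pi * (1 - r) ^ 2 * Real.log (1 / (1 - r)) +
        2 * √(1 - r) * (2 * √(2 * (1 - r)) * (2 * (1 - r))) := by gcongr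
    _ = Real.pi * (1 - r) ^ 2 * Real.log (1 / (1 - r)) +
        8 * (1 - r) * (√(1 - r) * √(2 * (1 - r))) := by ring
    _ ≤ Real.pi * (1 - r) ^ 2 * Real.log (1 / (1 - r)) +
        8 * (1 - r) * (3 / 2 * (1 - r)) := by gcongr
    _ ≤ _ := by nlinarith [Real.pi_gt_three, sq_nonneg (1 - r)]

lemma average_log_one_div_one_sub_normSq_le {r : ℝ} (hr : 1 / 2 ≤ r) (hr1 : r < 1) :
    ((1 - r) ^ 2)⁻¹ * ∫ z in ball (r : ℂ) (1 - r), Real.log (1 / (1 - normSq z)) ∂areaM ≤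
      Real.log (1 / (1 - r)) + 4 := by
  have hd : 0 < 1 - r := by linarith
  rw [areaM, Measure.restrict_smul, integral_smul_measure, ENNReal.toReal_inv,
    ENNReal.toReal_ofReal Real.pi_pos.le, smul_eq_mul]
  have h := setIntegral_log_one_div_one_sub_normSq_le hr hr1
  rw [← mul_assoc, ← mul_inv, inv_mul_le_iff₀ (by positivity)]
  linarith

/-- For every `ε > 0` there is `0 < r_ε < 1` such that for `r_ε < r < 1`,
`(1-r)⁻² ∫_{𝔻(r,1-r)} log(1/(1-|z|²)) dΣ ≤ (4/π + ε) log(1/(1-r))`; equivalently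
`F(r) ≤ (1-r)^{-4/π-ε}`. -/
theorem statement17 :
    ∀ ε : ℝ, 0 < ε → ∃ rε : ℝ, 0 < rε ∧ rε < 1 ∧
      ∀ r : ℝ, rε < r → r < 1 →
        (((1 - r) ^ 2)⁻¹ *
            ∫ z in ball ((r : ℂ)) (1 - r), Real.log (1 / (1 - normSq z)) ∂areaM)
          ≤ (4 / Real.pi + ε) * Real.log (1 / (1 - r)) ∧
        Fkor r ≤ (1 - r) ^ (-(4 / Real.pi) - ε) := by
  intro ε hε
  have hexp : Real.exp (-16) ≤ 1 / 2 := by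
    rw [Real.exp_neg, one_div]
    gcongr
    linarith [Real.add_one_le_exp (16 : ℝ)]
  refine ⟨1 - Real.exp (-16), by linarith, by linarith [Real.exp_pos (-16)], fun r hr hr1 => ?_⟩
  have hd : 0 < 1 - r := by linarith
  have hlog : Real.log (1 - r) ≤ -16 := by
    rw [Real.log_le_iff_le_exp hd]
    linarith
  have hlog' : Real.log (1 / (1 - r)) = -Real.log (1 - r) := by rw [one_div, Real.log_inv]
  have hpi : 5 / 4 ≤ 4 / Real.pi := by
    rw [le_div_iff₀ Real.pi_pos]
    linarith [Real.pi_lt_d2]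
  have hmain := average_log_one_div_one_sub_normSq_le (by linarith) hr1
  have hle : ((1 - r) ^ 2)⁻¹ *
      ∫ z in ball (r : ℂ) (1 - r), Real.log (1 / (1 - normSq z)) ∂areaM ≤
        (4 / Real.pi + ε) * Real.log (1 / (1 - r)) := by
    rw [hlog'] at hmain ⊢
    nlinarith
  refine ⟨hle, ?_⟩
  rw [Fkor, Real.rpow_def_of_pos hd, Real.exp_le_exp]
  rw [hlog'] at hle
  linarith
end
end
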